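/- arXiv:2411.11298 — 2 statements merged into one kernel-verified Lean document; each statement's English description precedes it below -/
import Mathlib

section
/- For every integer k ≥ 2, the string y_k = c · F*_{2k} over the alphabet {a, b, c} with a < b < c satisfies BWT(y_k) = c · b^{f_{2k-2} - k} · (a^{f_0} b)(a^{f_2} b)(a^{f_4} b) ⋯ (a^{f_{2k-2}} b), i.e., the concatenation of c, then b repeated f_{2k-2} - k times, then the blocks a^{f_{2j-2}} b for j = 1, 2, …, k in increasing order of j. In particular, ρ(BWT(y_k)) = 2k + 2 for every k ≥ 3. -/
/-! Basic definitions: strings as `List α`, rotations, runs, BWT, Lyndon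
factorization, ω-order, bijective BWT, and Fibonacci words. -/

variable {α : Type*}

/-- Left cyclic rotation by one symbol. -/
def rot (x : List α) : List α := x.drop 1 ++ x.take 1

/-- The list of all `|x|` cyclic rotations of `x`. -/
def rotations (x : List α) : List (List α) :=
  (List.range x.length).map (fun i => rot^[i] x)

/-- ρ: the number of maximal runs of equal consecutive symbols. -/
def runsCount [DecidableEq α] : List α → ℕ
  | [] => 0
  | [_] => 1
  | a :: b :: t => (if a = b then 0 else 1) + runsCount (b :: t)

/-- The Burrows–Wheeler transform: last symbols of the lexicographically
sorted rotations. -/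
def BWT [LinearOrder α] (w : List α) : List α :=
  (List.insertionSort (· ≤ ·) (rotations w)).filterMap List.getLast?

/-- The lexicographically smallest rotation of `x`. -/
def lexMinRotation [LinearOrder α] (x : List α) : List α :=
  (List.insertionSort (· ≤ ·) (rotations x)).headD x

/-- A Lyndon word: nonempty and strictly smaller than all its proper rotations. -/
def IsLyndon [LinearOrder α] (x : List α) : Prop :=
  x ≠ [] ∧ ∀ i < x.length, 0 < i → x < rot^[i] x

instance [LinearOrder α] : DecidablePred (IsLyndon (α := α)) := fun _ =>
  inferInstanceAs (Decidable (_ ∧ _))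

/-- The longest prefix of `w` that is a Lyndon word (the first Lyndon factor). -/
def firstLyndonFactor [LinearOrder α] (w : List α) : List α :=
  (((List.range (w.length + 1)).map (fun i => w.take i)).filter
    (fun x => decide (IsLyndon x))).getLastD []

def lyndonFactAux [LinearOrder α] : ℕ → List α → List (List α)
  | 0, _ => []
  | _, [] => []
  | fuel+1, w =>
      let p := firstLyndonFactor w
      if p.isEmpty then [] else p :: lyndonFactAux fuel (w.drop p.length)

/-- The Lyndon factorization of `w`: repeatedly peel off the longest Lyndon
prefix (equivalently, the unique nonincreasing factorization into Lyndon words). -/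
def lyndonFactorization [LinearOrder α] (w : List α) : List (List α) :=
  lyndonFactAux w.length w

/-- `listPow x n = x^n`. -/
def listPow (x : List α) : ℕ → List α
  | 0 => []
  | n+1 => x ++ listPow x n

/-- ω-order: `x ≤ω y` iff `x^∞ ≤ y^∞` lexicographically; comparing the
equal-length words `x^{|y|}` and `y^{|x|}` is equivalent. -/
def omegaLE [LinearOrder α] (x y : List α) : Prop :=
  listPow x y.length ≤ listPow y x.length

instance [LinearOrder α] : DecidableRel (omegaLE (α := α)) := fun _ _ =>
  inferInstanceAs (Decidable (_ ≤ _))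

/-- The bijective Burrows–Wheeler transform: last symbols of all rotations of
all Lyndon factors of `w`, sorted in ω-order. -/
def BBWT [LinearOrder α] (w : List α) : List α :=
  (List.insertionSort omegaLE
    (((lyndonFactorization w).map rotations).flatten)).filterMap List.getLast?

/-- Fibonacci words over symbols `a < b`: `F 0 = b`, `F 1 = a`,
`F (i+2) = F (i+1) ++ F i`. -/
def fibWordG (a b : α) : ℕ → List α
  | 0 => [b]
  | 1 => [a]
  | n+2 => fibWordG a b (n+1) ++ fibWordG a b n

/-- Fibonacci words over `Fin 2` with `a = 0 < b = 1`. -/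
def fibWord : ℕ → List (Fin 2) := fibWordG 0 1

/-- Fibonacci words over `Fin 3` with `a = 0 < b = 1 < c = 2`. -/
def fibWord3 : ℕ → List (Fin 3) := fibWordG 0 1

/-- `u` is smaller than `v` at a position inside both words, where they first differ. -/
inductive MismatchLT [LT α] : List α → List α → Prop
  | head {x y : α} (u v : List α) (h : x < y) : MismatchLT (x :: u) (y :: v)
  | cons (a : α) {u v : List α} (h : MismatchLT u v) : MismatchLT (a :: u) (a :: v)

namespace MismatchLT

theorem append [LT α] {u v : List α} (h : MismatchLT u v) (s t : List α) :
    MismatchLT (u ++ s) (v ++ t) := by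
  induction h with
  | head u v h => exact .head _ _ h
  | cons a _ ih => exact .cons a ih

theorem append_left [LT α] {u v : List α} (h : MismatchLT u v) (s : List α) :
    MismatchLT (s ++ u) (s ++ v) := by
  induction s with
  | nil => exact h
  | cons a _ ih => exact .cons a ih

theorem lt [LinearOrder α] {u v : List α} (h : MismatchLT u v) : u < v := by
  induction h with
  | head u v h => exact List.Lex.rel h
  | cons a _ ih => exact List.Lex.cons ih

theorem ne [LinearOrder α] {u v : List α} (h : MismatchLT u v) : u ≠ v := h.lt.ne

end MismatchLT

/-! ### Rotations -/

theorem rot_iterate (x : List α) (i : ℕ) : rot^[i] x = x.rotate i := by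
  induction i with
  | zero => simp
  | succ i ih =>
    rw [Function.iterate_succ_apply', ih, ← List.rotate_rotate]
    cases x.rotate i <;> simp [rot]

theorem length_rotations (x : List α) : (rotations x).length = x.length := by
  simp [rotations]

theorem mem_rotations {x v : List α} (hx : x ≠ []) : v ∈ rotations x ↔ x ~r v := by
  simp only [rotations, rot_iterate, List.mem_map, List.mem_range]
  constructor
  · rintro ⟨i, -, rfl⟩
    exact ⟨i, rfl⟩
  · rintro ⟨i, rfl⟩
    exact ⟨i % x.length, Nat.mod_lt _ (List.length_pos_of_ne_nil hx), List.rotate_mod _ _⟩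

theorem lexMinRotation_eq [LinearOrder α] {x l : List α} (hx : x ≠ []) (hl : x ~r l)
    (hmin : ∀ v, l ~r v → l ≤ v) : lexMinRotation x = l := by
  have hsort := List.pairwise_insertionSort (· ≤ ·) (rotations x)
  have hmem : ∀ v, v ∈ List.insertionSort (· ≤ ·) (rotations x) ↔ x ~r v := fun v => by
    rw [List.mem_insertionSort, mem_rotations hx]
  unfold lexMinRotation
  generalize List.insertionSort (· ≤ ·) (rotations x) = S at hsort hmem
  cases S with
  | nil => simpa using (hmem l).2 hl
  | cons m S =>
    apply le_antisymm
    · rcases List.mem_cons.1 ((hmem l).2 hl) with h | h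
      · exact h.ge
      · exact (List.pairwise_cons.1 hsort).1 l h
    · exact hmin m (hl.symm.trans ((hmem m).1 List.mem_cons_self))

theorem isRotated_flatMap {β : Type*} {u v : List α} (h : u ~r v) (f : α → List β) :
    u.flatMap f ~r v.flatMap f := by
  obtain ⟨n, hn, rfl⟩ := List.isRotated_iff_mod.1 h
  rw [List.rotate_eq_drop_append_take hn]
  conv_lhs => rw [← List.take_append_drop n u]
  rw [List.flatMap_append, List.flatMap_append]
  exact List.isRotated_append

/-- Every proper nonempty suffix exceeds the whole word at a mismatch. -/
def SuffixMinimal [LT α] (w : List α) : Prop :=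
  ∀ s, s <:+ w → s ≠ [] → s ≠ w → MismatchLT w s

theorem SuffixMinimal.le_of_isRotated [LinearOrder α] {w v : List α} (hw : SuffixMinimal w)
    (h : w ~r v) : w ≤ v := by
  obtain ⟨n, hn, rfl⟩ := List.isRotated_iff_mod.1 h
  rw [List.rotate_eq_drop_append_take hn]
  by_cases h1 : w.drop n = []
  · have : n = w.length := le_antisymm hn (List.drop_eq_nil_iff.1 h1)
    simp [this]
  by_cases h2 : w.drop n = w
  · have := congrArg List.length h2
    rw [List.length_drop] at this
    rcases Nat.eq_zero_or_pos n with rfl | hpos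
    · simp
    · have : w = [] := List.length_eq_zero_iff.1 (by omega)
      simp [this]
  · simpa using ((hw _ (List.drop_suffix n w) h1 h2).append [] (w.take n)).lt.le

/-! ### The morphism `a ↦ aab, b ↦ ab, c ↦ c` and the words it generates -/

/-- The letter images of the morphism `a ↦ aab, b ↦ ab, c ↦ c`. -/
def lyndonLetter : Fin 3 → List (Fin 3)
  | 0 => [0, 0, 1]
  | 1 => [0, 1]
  | 2 => [2]

/-- The morphism `a ↦ aab, b ↦ ab, c ↦ c`. -/
def lyndonMor (w : List (Fin 3)) : List (Fin 3) := w.flatMap lyndonLetter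

theorem lyndonMor_nil : lyndonMor [] = [] := rfl

theorem lyndonMor_cons (x : Fin 3) (w : List (Fin 3)) :
    lyndonMor (x :: w) = lyndonLetter x ++ lyndonMor w := rfl

theorem lyndonMor_append (u v : List (Fin 3)) :
    lyndonMor (u ++ v) = lyndonMor u ++ lyndonMor v := List.flatMap_append

theorem MismatchLT.lyndonMor {u v : List (Fin 3)} (h : MismatchLT u v) :
    MismatchLT (lyndonMor u) (lyndonMor v) := by
  induction h with
  | @head x y u v h =>
    simp only [lyndonMor_cons]
    fin_cases x <;> fin_cases y <;> first | (exact absurd h (by decide)) | skip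
    · exact .cons 0 (.head _ _ (by decide))
    · exact .head _ _ (by decide)
    · exact .head _ _ (by decide)
  | cons a _ ih =>
    simp only [lyndonMor_cons]
    exact ih.append_left _

theorem suffix_lyndonMor {w s : List (Fin 3)} (hw : 2 ∉ w) (h : s <:+ lyndonMor w) :
    ∃ t, t <:+ w ∧ (s = lyndonMor t ∨ s = 1 :: lyndonMor t ∨
      (0 :: t <:+ w ∧ s = 0 :: 1 :: lyndonMor t)) := by
  induction w with
  | nil => exact ⟨[], List.suffix_rfl, .inl (List.suffix_nil.1 h)⟩
  | cons x w ih =>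
    rw [List.mem_cons, not_or] at hw
    have rec_case : s <:+ lyndonMor w → ∃ t, t <:+ x :: w ∧ (s = lyndonMor t ∨
        s = 1 :: lyndonMor t ∨ (0 :: t <:+ x :: w ∧ s = 0 :: 1 :: lyndonMor t)) := fun h' => by
      obtain ⟨t, ht, hs⟩ := ih hw.2 h'
      have hcons : w <:+ x :: w := List.suffix_cons x w
      exact ⟨t, ht.trans hcons, hs.imp_right (Or.imp_right (And.imp_left (·.trans hcons)))⟩
    have hx := hw.1
    fin_cases x
    · change s <:+ 0 :: 0 :: 1 :: lyndonMor w at h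
      rw [List.suffix_cons_iff, List.suffix_cons_iff, List.suffix_cons_iff] at h
      rcases h with h | h | h | h
      · exact ⟨_, List.suffix_rfl, .inl h⟩
      · exact ⟨w, List.suffix_cons _ _, .inr (.inr ⟨List.suffix_rfl, h⟩)⟩
      · exact ⟨w, List.suffix_cons _ _, .inr (.inl h)⟩
      · exact rec_case h
    · change s <:+ 0 :: 1 :: lyndonMor w at h
      rw [List.suffix_cons_iff, List.suffix_cons_iff] at h
      rcases h with h | h | h
      · exact ⟨_, List.suffix_rfl, .inl h⟩
      · exact ⟨w, List.suffix_cons _ _, .inr (.inl h)⟩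
      · exact rec_case h
    · exact absurd rfl hx

theorem SuffixMinimal.lyndonMor {w : List (Fin 3)} (h2 : 2 ∉ w) (h0 : ∃ u, w = 0 :: u)
    (hw : SuffixMinimal w) : SuffixMinimal (lyndonMor w) := by
  intro s hs hne hprop
  obtain ⟨t, ht, rfl | rfl | ⟨-, rfl⟩⟩ := suffix_lyndonMor h2 hs
  · refine (hw t ht ?_ ?_).lyndonMor
    · rintro rfl
      exact hne rfl
    · rintro rfl
      exact hprop rfl
  · obtain ⟨u, rfl⟩ := h0
    exact .head _ _ (by decide)
  · obtain ⟨u, rfl⟩ := h0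
    exact .cons 0 (.head _ _ (by decide))

theorem two_notMem_lyndonMor {w : List (Fin 3)} (hw : 2 ∉ w) : 2 ∉ lyndonMor w := by
  simp only [lyndonMor, List.mem_flatMap, not_exists, not_and]
  intro x hx
  fin_cases x
  · decide
  · decide
  · exact absurd hx hw

theorem length_lyndonMor {w : List (Fin 3)} (hw : 2 ∉ w) :
    (lyndonMor w).length = 2 * w.length + w.count 0 := by
  induction w with
  | nil => rfl
  | cons x w ih =>
    rw [List.mem_cons, not_or] at hw
    have hx := hw.1
    rw [lyndonMor_cons, List.length_append, ih hw.2, List.length_cons, List.count_cons]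
    fin_cases x
    · simp [lyndonLetter]; omega
    · simp [lyndonLetter]; omega
    · exact absurd rfl hx

theorem count_zero_lyndonMor {w : List (Fin 3)} (hw : 2 ∉ w) :
    (lyndonMor w).count 0 = w.length + w.count 0 := by
  induction w with
  | nil => rfl
  | cons x w ih =>
    rw [List.mem_cons, not_or] at hw
    have hx := hw.1
    rw [lyndonMor_cons, List.count_append, ih hw.2, List.length_cons, List.count_cons]
    fin_cases x
    · simp [lyndonLetter]; omega
    · simp [lyndonLetter]; omega
    · exact absurd rfl hx

/-- The Lyndon conjugates of the Fibonacci words of even index. -/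
def lyndonFib : ℕ → List (Fin 3)
  | 0 => [1]
  | k + 1 => lyndonMor (lyndonFib k)

theorem two_notMem_lyndonFib (k : ℕ) : 2 ∉ lyndonFib k := by
  induction k with
  | zero => decide
  | succ k ih => exact two_notMem_lyndonMor ih

theorem lyndonFib_succ_eq_cons (k : ℕ) : ∃ u, lyndonFib (k + 1) = 0 :: u := by
  induction k with
  | zero => exact ⟨[1], rfl⟩
  | succ k ih =>
    obtain ⟨u, hu⟩ := ih
    rw [lyndonFib, hu]
    exact ⟨_, rfl⟩

theorem suffixMinimal_lyndonFib_succ (k : ℕ) : SuffixMinimal (lyndonFib (k + 1)) := by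
  induction k with
  | zero =>
    intro s hs hne hprop
    change s <:+ [0, 1] at hs
    change s ≠ [0, 1] at hprop
    rw [List.suffix_cons_iff, List.suffix_cons_iff, List.suffix_nil] at hs
    rcases hs with rfl | rfl | rfl
    · exact absurd rfl hprop
    · exact .head _ _ (by decide)
    · exact absurd rfl hne
  | succ k ih => exact ih.lyndonMor (two_notMem_lyndonFib _) (lyndonFib_succ_eq_cons k)

theorem length_fibWord3_add_two (n : ℕ) :
    (fibWord3 (n + 2)).length = (fibWord3 (n + 1)).length + (fibWord3 n).length :=
  List.length_append

theorem length_count_lyndonFib (k : ℕ) :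
    (lyndonFib k).length = (fibWord3 (2 * k)).length ∧
      (lyndonFib k).length + (lyndonFib k).count 0 = (fibWord3 (2 * k + 1)).length := by
  induction k with
  | zero => decide
  | succ k ih =>
    have h1 := length_fibWord3_add_two (2 * k)
    have h2 := length_fibWord3_add_two (2 * k + 1)
    rw [lyndonFib, length_lyndonMor (two_notMem_lyndonFib k),
      count_zero_lyndonMor (two_notMem_lyndonFib k), Nat.mul_succ, h2, h1]
    omega

theorem succ_le_length_fibWord3 (k : ℕ) : k + 1 ≤ (fibWord3 (2 * k)).length := by
  induction k with
  | zero => decide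
  | succ k ih =>
    have h1 := length_fibWord3_add_two (2 * k)
    have h2 := length_count_lyndonFib k
    rw [Nat.mul_succ]
    omega

/-! ### Conjugacy with the Fibonacci words -/

/-- The letter images of the square of the Fibonacci morphism. -/
def fibLetter : Fin 3 → List (Fin 3)
  | 0 => [0, 1, 0]
  | _ => [0, 1]

theorem fibWord3_add_two (n : ℕ) : fibWord3 (n + 2) = (fibWord3 n).flatMap fibLetter := by
  induction n using Nat.twoStepInduction with
  | zero => rfl
  | one => rfl
  | more n ih1 ih2 =>
    have h : fibWord3 (n + 2) = fibWord3 (n + 1) ++ fibWord3 n := rfl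
    rw [h, List.flatMap_append, ← ih1, ← ih2]
    rfl

theorem two_notMem_fibWord3 (n : ℕ) : 2 ∉ fibWord3 n := by
  induction n using Nat.twoStepInduction with
  | zero => decide
  | one => decide
  | more n ih1 ih2 => exact fun h => (List.mem_append.1 h).elim ih2 ih1

theorem fibWord3_ne_nil (n : ℕ) : fibWord3 n ≠ [] := by
  induction n using Nat.twoStepInduction with
  | zero => decide
  | one => decide
  | more n ih1 ih2 => exact fun h => ih1 (List.append_eq_nil_iff.1 h).2

theorem flatMap_fibLetter_append {w : List (Fin 3)} (hw : 2 ∉ w) :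
    w.flatMap fibLetter ++ [0, 1] = [0, 1] ++ lyndonMor w := by
  induction w with
  | nil => rfl
  | cons x w ih =>
    rw [List.mem_cons, not_or] at hw
    have hx := hw.1
    rw [List.flatMap_cons, List.append_assoc, ih hw.2, lyndonMor_cons]
    fin_cases x
    · rfl
    · rfl
    · exact absurd rfl hx

theorem flatMap_fibLetter_isRotated {w : List (Fin 3)} (hw : 2 ∉ w) :
    w.flatMap fibLetter ~r lyndonMor w := by
  have h := flatMap_fibLetter_append hw
  cases w with
  | nil => exact List.IsRotated.refl _
  | cons x w =>
    obtain ⟨z, hz⟩ : ∃ z, (x :: w).flatMap fibLetter = [0, 1] ++ z := by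
      rw [List.flatMap_cons]
      fin_cases x <;> exact ⟨_, rfl⟩
    rw [hz, List.append_assoc, List.append_cancel_left_eq] at h
    rw [hz, ← h]
    exact List.isRotated_append

theorem fibWord3_isRotated_lyndonFib (k : ℕ) : fibWord3 (2 * k) ~r lyndonFib k := by
  induction k with
  | zero => exact List.IsRotated.refl _
  | succ k ih =>
    rw [Nat.mul_succ, fibWord3_add_two]
    exact (flatMap_fibLetter_isRotated (two_notMem_fibWord3 _)).trans (isRotated_flatMap ih _)

theorem lexMinRotation_fibWord3 (k : ℕ) :
    lexMinRotation (fibWord3 (2 * (k + 1))) = lyndonFib (k + 1) :=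
  lexMinRotation_eq (fibWord3_ne_nil _) (fibWord3_isRotated_lyndonFib _)
    fun _ => (suffixMinimal_lyndonFib_succ k).le_of_isRotated

/-! ### Sorted suffixes -/

/-- `S` lists the proper suffixes `s` of `w`, each paired with the letter preceding it, in the
order of the words `s ++ [2]`, and `w ++ [2]` comes before all of these. -/
structure SortedSuffixes (w : List (Fin 3)) (S : List (Fin 3 × List (Fin 3))) : Prop where
  length_eq : S.length = w.length
  suffix : ∀ p ∈ S, p.1 :: p.2 <:+ w
  sorted : ((2, w) :: S).Pairwise fun p q => MismatchLT (p.2 ++ [2]) (q.2 ++ [2])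

theorem BWT_eq_of_sorted [LinearOrder α] {y : List α} (hy : y ≠ []) {R : List (List α)}
    (hlen : R.length = y.length) (hrot : ∀ v ∈ R, y ~r v) (hlt : R.Pairwise (· < ·)) :
    BWT y = R.filterMap List.getLast? := by
  have hperm : R.Perm (rotations y) :=
    (List.subperm_of_subset (hlt.imp fun h => h.ne)
      fun v hv => (mem_rotations hy).2 (hrot v hv)).perm_of_length_le
      (by rw [length_rotations, hlen])
  have : List.insertionSort (· ≤ ·) (rotations y) = R :=
    ((List.perm_insertionSort _ _).trans hperm.symm).eq_of_pairwise
      (fun _ _ _ _ h h' => le_antisymm h h') (List.pairwise_insertionSort _ _)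
      (hlt.imp fun h => h.le)
  rw [BWT, this]

theorem SortedSuffixes.BWT_eq {w : List (Fin 3)} {S : List (Fin 3 × List (Fin 3))}
    (h : SortedSuffixes w S) : BWT (2 :: w) = 2 :: S.map Prod.fst := by
  set f : Fin 3 × List (Fin 3) → List (Fin 3) :=
    fun p => p.2 ++ 2 :: w.take (w.length - p.2.length) with hf
  have hsuf : ∀ p ∈ (2, w) :: S, ∃ t, 2 :: w = t ++ p.1 :: p.2 ∧ f p = p.2 ++ (t ++ [p.1]) := by
    intro p hp
    rcases List.mem_cons.1 hp with rfl | hp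
    · exact ⟨[], by simp [hf]⟩
    · obtain ⟨t, rfl⟩ := h.suffix p hp
      refine ⟨2 :: t, rfl, ?_⟩
      have : (t ++ p.1 :: p.2).length - p.2.length = (t ++ [p.1]).length := by simp; omega
      simp only [hf, this]
      rw [List.append_cons t p.1 p.2, List.take_left, List.cons_append]
  rw [BWT_eq_of_sorted (R := ((2, w) :: S).map f) (by simp) (by simp [h.length_eq]),
    List.filterMap_map, ← List.map_cons (f := Prod.fst) (a := ((2 : Fin 3), w)),
    ← List.filterMap_eq_map]
  · refine List.filterMap_congr fun p hp => ?_
    obtain ⟨t, -, ht⟩ := hsuf p hp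
    simp [ht]
  · simp only [List.mem_map, forall_exists_index, and_imp]
    rintro _ p hp rfl
    obtain ⟨t, ht, hfp⟩ := hsuf p hp
    rw [ht, hfp, List.append_cons]
    exact List.isRotated_append
  · refine List.pairwise_map.2 (h.sorted.imp fun {p q} hpq => ?_)
    simpa [hf] using (hpq.append (w.take (w.length - p.2.length))
      (w.take (w.length - q.2.length))).lt

theorem countP_tails_head [DecidableEq α] (a : α) (w : List α) :
    w.tails.countP (fun s => decide (s.head? = some a)) = w.count a := by
  induction w with
  | nil => simp
  | cons x w ih => simp [List.countP_cons, List.count_cons, ih]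

theorem SortedSuffixes.countP_head {w : List (Fin 3)} {S : List (Fin 3 × List (Fin 3))}
    (h : SortedSuffixes w S) (h0 : ∃ u, w = 0 :: u) :
    S.countP (fun p => decide (p.2.head? = some 0)) + 1 = w.count 0 := by
  have hperm : (((2, w) :: S).map Prod.snd).Perm w.tails := by
    refine (List.subperm_of_subset ?_ fun s hs => ?_).perm_of_length_le ?_
    · exact List.pairwise_map.2 (h.sorted.imp fun hpq heq => hpq.ne (by rw [heq]))
    · obtain ⟨p, hp, rfl⟩ := List.mem_map.1 hs
      rw [List.mem_tails]
      rcases List.mem_cons.1 hp with rfl | hp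
      · exact List.suffix_rfl
      · exact (List.suffix_cons _ _).trans (h.suffix p hp)
    · simp [h.length_eq]
  rw [← countP_tails_head, ← hperm.countP_eq, List.countP_map, List.countP_cons]
  obtain ⟨u, rfl⟩ := h0
  simp [Function.comp_def]

/-- The sorted proper suffixes of `lyndonMor w`, from those of `w`. -/
def lyndonSuffixes (S : List (Fin 3 × List (Fin 3))) : List (Fin 3 × List (Fin 3)) :=
  (S.filter fun p => decide (p.2.head? = some 0)).map (fun p => (1, lyndonMor p.2)) ++
    (S.map (fun p => (p.1, 0 :: 1 :: lyndonMor p.2)) ++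
      (S.map (fun p => (0, 1 :: lyndonMor p.2)) ++ [(1, [])]))

theorem suffix_lyndonMor_of_suffix {u w : List (Fin 3)} (h : u <:+ w) :
    lyndonMor u <:+ lyndonMor w := by
  obtain ⟨t, rfl⟩ := h
  rw [lyndonMor_append]
  exact List.suffix_append _ _

theorem cons_one_suffix_lyndonMor {x : Fin 3} {u w : List (Fin 3)} (hw : 2 ∉ w)
    (h : x :: u <:+ w) : 0 :: 1 :: lyndonMor u <:+ lyndonMor w := by
  have hx : x ≠ 2 := fun hx => hw (h.subset (by simp [hx]))
  refine List.IsSuffix.trans ?_ (suffix_lyndonMor_of_suffix h)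
  fin_cases x
  · exact ⟨[0], rfl⟩
  · exact ⟨[], rfl⟩
  · exact absurd rfl hx

theorem cons_suffix_lyndonMor {x : Fin 3} {u w : List (Fin 3)} (hw : 2 ∉ w)
    (h0 : ∃ v, w = 0 :: v) (h : x :: u <:+ w) :
    x :: 0 :: 1 :: lyndonMor u <:+ lyndonMor w := by
  have hx : x ≠ 2 := fun hx => hw (h.subset (by simp [hx]))
  fin_cases x
  · exact suffix_lyndonMor_of_suffix h
  · obtain ⟨t, rfl⟩ := h
    obtain rfl | ⟨t, z, rfl⟩ := List.eq_nil_or_concat' t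
    · obtain ⟨v, hv⟩ := h0
      simp at hv
    · have hz : z :: 1 :: u <:+ t ++ [z] ++ 1 :: u := ⟨t, by simp⟩
      exact (List.suffix_cons 0 (1 :: lyndonMor (1 :: u))).trans (cons_one_suffix_lyndonMor hw hz)
  · exact absurd rfl hx

theorem SortedSuffixes.lyndonMor {w : List (Fin 3)} {S : List (Fin 3 × List (Fin 3))}
    (h : SortedSuffixes w S) (h2 : 2 ∉ w) (h0 : ∃ u, w = 0 :: u) :
    SortedSuffixes (lyndonMor w) (lyndonSuffixes S) := by
  have hmor : ∀ {u v : List (Fin 3)}, MismatchLT (u ++ [2]) (v ++ [2]) →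
      MismatchLT (_root_.lyndonMor u ++ [2]) (_root_.lyndonMor v ++ [2]) := fun {u v} huv => by
    have := huv.lyndonMor
    rwa [lyndonMor_append, lyndonMor_append] at this
  refine ⟨?_, ?_, ?_⟩
  · have := h.countP_head h0
    rw [List.countP_eq_length_filter] at this
    rw [length_lyndonMor h2]
    simp only [lyndonSuffixes, List.length_append, List.length_map, List.length_singleton,
      h.length_eq]
    omega
  · intro p hp
    simp only [lyndonSuffixes, List.mem_append, List.mem_map, List.mem_singleton] at hp
    rcases hp with ⟨q, hq, rfl⟩ | ⟨q, hq, rfl⟩ | ⟨q, hq, rfl⟩ | rfl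
    · exact (List.suffix_cons _ _).trans
        (cons_one_suffix_lyndonMor h2 (h.suffix q (List.mem_of_mem_filter hq)))
    · exact cons_suffix_lyndonMor h2 h0 (h.suffix q hq)
    · exact cons_one_suffix_lyndonMor h2 (h.suffix q hq)
    · obtain rfl | ⟨t, z, rfl⟩ := List.eq_nil_or_concat' w
      · simp at h0
      · exact (List.suffix_cons _ _).trans
          (cons_one_suffix_lyndonMor h2 (u := []) (List.suffix_append t [z]))
  · have hfirst : ∀ s : List (Fin 3), s.head? = some 0 → ∀ v,
        MismatchLT (_root_.lyndonMor s ++ [2]) (0 :: 1 :: v) := by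
      intro s hs v
      obtain ⟨u, rfl⟩ := List.head?_eq_some_iff.1 hs
      exact .cons 0 (.head _ _ (by decide))
    have hhead := List.pairwise_cons.1 h.sorted
    have hleft : ∀ p ∈ (2, _root_.lyndonMor w) ::
        (S.filter fun p => decide (p.2.head? = some 0)).map
          (fun p => ((1 : Fin 3), _root_.lyndonMor p.2)),
        ∃ s : List (Fin 3), s.head? = some 0 ∧ p.2 = _root_.lyndonMor s := by
      intro p hp
      rcases List.mem_cons.1 hp with rfl | hp
      · obtain ⟨u, rfl⟩ := h0
        exact ⟨0 :: u, rfl, rfl⟩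
      · obtain ⟨q, hq, rfl⟩ := List.mem_map.1 hp
        exact ⟨q.2, of_decide_eq_true (List.mem_filter.1 hq).2, rfl⟩
    rw [lyndonSuffixes, ← List.cons_append]
    refine List.pairwise_append.2 ⟨?_, List.pairwise_append.2 ⟨?_, List.pairwise_append.2
      ⟨?_, List.pairwise_singleton _ _, ?_⟩, ?_⟩, ?_⟩
    · refine List.pairwise_cons.2 ⟨?_, List.pairwise_map.2 ((hhead.2.filter _).imp hmor)⟩
      intro p hp
      obtain ⟨q, hq, rfl⟩ := List.mem_map.1 hp
      exact hmor (hhead.1 q (List.mem_of_mem_filter hq))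
    · exact List.pairwise_map.2 (hhead.2.imp fun hpq => .cons 0 (.cons 1 (hmor hpq)))
    · exact List.pairwise_map.2 (hhead.2.imp fun hpq => .cons 1 (hmor hpq))
    · intro p hp q hq
      obtain ⟨p, -, rfl⟩ := List.mem_map.1 hp
      obtain rfl := List.mem_singleton.1 hq
      exact .head _ _ (by decide)
    · intro p hp q hq
      obtain ⟨p, -, rfl⟩ := List.mem_map.1 hp
      rcases List.mem_append.1 hq with hq | hq
      · obtain ⟨q, -, rfl⟩ := List.mem_map.1 hq
        exact .head _ _ (by decide)
      · obtain rfl := List.mem_singleton.1 hq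
        exact .head _ _ (by decide)
    · intro p hp q hq
      obtain ⟨s, hs, hps⟩ := hleft p hp
      rw [hps]
      rcases List.mem_append.1 hq with hq | hq
      · obtain ⟨q, -, rfl⟩ := List.mem_map.1 hq
        exact hfirst s hs _
      · obtain ⟨u, rfl⟩ := List.head?_eq_some_iff.1 hs
        rcases List.mem_append.1 hq with hq | hq
        · obtain ⟨q, -, rfl⟩ := List.mem_map.1 hq
          exact .head _ _ (by decide)
        · obtain rfl := List.mem_singleton.1 hq
          exact .head _ _ (by decide)

theorem SortedSuffixes.map_fst_lyndonSuffixes {w : List (Fin 3)}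
    {S : List (Fin 3 × List (Fin 3))} (h : SortedSuffixes w S) (h0 : ∃ u, w = 0 :: u) :
    (lyndonSuffixes S).map Prod.fst = List.replicate (w.count 0 - 1) 1 ++
      (S.map Prod.fst ++ (List.replicate w.length 0 ++ [1])) := by
  have hcount := h.countP_head h0
  rw [List.countP_eq_length_filter] at hcount
  rw [← hcount, ← h.length_eq]
  simp [lyndonSuffixes, Function.comp_def, List.map_const']

/-- The word `(a^{n₁} b)(a^{n₂} b) ⋯` for a list of exponents `n₁, n₂, …`. -/
def blocks (l : List ℕ) : List (Fin 3) :=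
  (l.map fun n => List.replicate n 0 ++ [1]).flatten

theorem exists_sortedSuffixes_lyndonFib (k : ℕ) : ∃ S, SortedSuffixes (lyndonFib (k + 1)) S ∧
    S.map Prod.fst = List.replicate ((fibWord3 (2 * k)).length - (k + 1)) 1 ++
      blocks ((List.range (k + 1)).map fun j => (fibWord3 (2 * j)).length) := by
  induction k with
  | zero =>
    refine ⟨[(0, [1]), (1, [])], ⟨rfl, ?_, ?_⟩, rfl⟩
    · intro p hp
      rcases List.mem_cons.1 hp with rfl | hp
      · exact List.suffix_rfl
      · obtain rfl := List.mem_singleton.1 hp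
        exact List.suffix_cons 0 [1]
    · change List.Pairwise _ [((2 : Fin 3), ([0, 1] : List (Fin 3))), (0, [1]), (1, [])]
      refine List.pairwise_cons.2 ⟨?_, List.pairwise_pair.2 (.head _ _ (by decide))⟩
      intro p hp
      rcases List.mem_cons.1 hp with rfl | hp
      · exact .head _ _ (by decide)
      · obtain rfl := List.mem_singleton.1 hp
        exact .head _ _ (by decide)
  | succ k ih =>
    obtain ⟨S, hS, hfst⟩ := ih
    have h0 := lyndonFib_succ_eq_cons k
    refine ⟨_, hS.lyndonMor (two_notMem_lyndonFib _) h0, ?_⟩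
    have hlen := length_count_lyndonFib (k + 1)
    have hle := succ_le_length_fibWord3 k
    have h1 : _ = (fibWord3 (2 * k + 2)).length := hlen.1
    have h2 : _ = (fibWord3 (2 * k + 3)).length := hlen.2
    have h3 : (fibWord3 (2 * k + 2)).length = _ := length_fibWord3_add_two (2 * k)
    have h4 : (fibWord3 (2 * k + 3)).length = (fibWord3 (2 * k + 2)).length + _ :=
      length_fibWord3_add_two (2 * k + 1)
    have hpos : 0 < (lyndonFib (k + 1)).count 0 := by
      obtain ⟨u, hu⟩ := h0
      simp [hu]
    have hexp : (fibWord3 (2 * (k + 1))).length - (k + 1 + 1) =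
        ((lyndonFib (k + 1)).count 0 - 1) + ((fibWord3 (2 * k)).length - (k + 1)) := by
      rw [Nat.mul_succ]
      omega
    rw [hS.map_fst_lyndonSuffixes h0, hfst, hexp, List.range_succ (n := k + 1), hlen.1]
    simp [blocks, ← List.replicate_append_replicate]

/-! ### Counting runs -/

theorem runsCount_replicate_append [DecidableEq α] (a : α) (n : ℕ) (l : List α) :
    runsCount (List.replicate (n + 1) a ++ l) = runsCount (a :: l) := by
  induction n with
  | zero => rfl
  | succ n ih =>
    rw [← ih]
    simp [List.replicate_succ, runsCount]

theorem runsCount_cons_blocks {l : List ℕ} (hl : ∀ n ∈ l, 0 < n) :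
    runsCount (1 :: blocks l) = 2 * l.length + 1 := by
  induction l with
  | nil => rfl
  | cons n l ih =>
    rw [List.forall_mem_cons] at hl
    obtain ⟨m, rfl⟩ := Nat.exists_eq_succ_of_ne_zero hl.1.ne'
    have h : (1 : Fin 3) :: blocks ((m + 1) :: l) =
        1 :: 0 :: (List.replicate m 0 ++ 1 :: blocks l) := by
      simp [blocks, List.replicate_succ]
    have h' := runsCount_replicate_append (0 : Fin 3) m (1 :: blocks l)
    rw [List.replicate_succ, List.cons_append] at h'
    rw [Nat.succ_eq_add_one, h, runsCount, h', runsCount, ih hl.2, List.length_cons]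
    simp
    omega

/-- for every `k ≥ 2`, `BWT(c · F*_{2k}) =
c · b^{f_{2k-2}-k} · (a^{f_0} b)(a^{f_2} b) ⋯ (a^{f_{2k-2}} b)`, and in
particular `ρ(BWT(c · F*_{2k})) = 2k + 2` for `k ≥ 3`. -/
theorem stmt3 (k : ℕ) (hk : 2 ≤ k) :
    BWT ((2 : Fin 3) :: lexMinRotation (fibWord3 (2 * k))) =
      [2] ++ List.replicate ((fibWord3 (2 * k - 2)).length - k) 1 ++
        ((List.range k).map
          (fun j => List.replicate (fibWord3 (2 * j)).length (0 : Fin 3) ++ [1])).flatten ∧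
    (3 ≤ k →
      runsCount (BWT ((2 : Fin 3) :: lexMinRotation (fibWord3 (2 * k)))) = 2 * k + 2) := by
  obtain ⟨k, rfl⟩ : ∃ m, k = m + 1 := ⟨k - 1, by omega⟩
  obtain ⟨S, hS, hfst⟩ := exists_sortedSuffixes_lyndonFib k
  have hBWT := hS.BWT_eq
  rw [hfst] at hBWT
  rw [lexMinRotation_fibWord3, hBWT]
  refine ⟨by simp [blocks, Function.comp_def, Nat.mul_succ], fun hk3 => ?_⟩
  obtain ⟨m, hm⟩ : ∃ m, (fibWord3 (2 * k)).length - (k + 1) = m + 1 := by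
    obtain ⟨j, rfl⟩ : ∃ j, k = j + 2 := ⟨k - 2, by omega⟩
    have h1 : (fibWord3 (2 * j + 4)).length = (fibWord3 (2 * j + 3)).length + _ :=
      length_fibWord3_add_two (2 * j + 2)
    have h2 : (fibWord3 (2 * j + 3)).length = (fibWord3 (2 * j + 2)).length + _ :=
      length_fibWord3_add_two (2 * j + 1)
    have h3 := length_fibWord3_add_two (2 * j)
    have h4 := succ_le_length_fibWord3 j
    have h5 := List.length_pos_of_ne_nil (fibWord3_ne_nil (2 * j + 1))
    refine ⟨(fibWord3 (2 * (j + 2))).length - (j + 2 + 1) - 1, ?_⟩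
    rw [Nat.mul_add, show 2 * 2 = 4 from rfl]
    omega
  have hruns := runsCount_replicate_append (1 : Fin 3) m
    (blocks ((List.range (k + 1)).map fun j => (fibWord3 (2 * j)).length))
  rw [runsCount_cons_blocks (by
    simp only [List.mem_map, forall_exists_index, and_imp]
    rintro _ j - rfl
    exact List.length_pos_of_ne_nil (fibWord3_ne_nil _))] at hruns
  rw [List.replicate_succ, List.cons_append] at hruns
  rw [hm, List.replicate_succ, List.cons_append, runsCount, hruns]
  simp
  omega
end

section
/- For every integer k ≥ 0, F*_{2k} = θ^k(b), where θ^k denotes the k-fold composition of the morphism θ. -/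
/-! Basic definitions: strings as `List α`, rotations, runs, BWT, Lyndon
factorization, ω-order, bijective BWT, and Fibonacci words. -/

variable {α : Type*}

/-- The morphism `θ(a) = aab`, `θ(b) = ab` (with `a = 0`, `b = 1`). -/
def theta (w : List (Fin 2)) : List (Fin 2) :=
  (w.map (fun c => if c = 0 then [0, 0, 1] else [0, 1])).flatten

theorem rot_eq_rotate_one {α : Type*} (x : List α) : rot x = x.rotate 1 := by
  cases x <;> simp [rot]

theorem rot_iterate_eq_rotate {α : Type*} (x : List α) (n : ℕ) : rot^[n] x = x.rotate n := by
  induction n with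
  | zero => simp
  | succ n ih => rw [Function.iterate_succ_apply', ih, rot_eq_rotate_one, List.rotate_rotate]

theorem mem_rotations_iff {α : Type*} {x y : List α} (hx : x ≠ []) :
    y ∈ rotations x ↔ x ~r y := by
  simp only [rotations, List.mem_map, List.mem_range, rot_iterate_eq_rotate]
  constructor
  · rintro ⟨n, -, rfl⟩
    exact ⟨n, rfl⟩
  · rintro ⟨n, rfl⟩
    exact ⟨n % x.length, Nat.mod_lt _ (List.length_pos_iff.2 hx), List.rotate_mod x n⟩

theorem List.Pairwise.headD_le {α : Type*} [Preorder α] {l : List α} (h : l.Pairwise (· ≤ ·))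
    {y : α} (hy : y ∈ l) (d : α) : l.headD d ≤ y := by
  cases h with
  | nil => simp at hy
  | cons h _ =>
    rcases List.mem_cons.1 hy with rfl | hy
    · exact le_rfl
    · exact h y hy

/-- A rotation of `x` that is at most each of its own rotations is the least rotation of `x`. -/
theorem lexMinRotation_eq_of_isRotated {α : Type*} [LinearOrder α] {x y : List α} (hx : x ≠ [])
    (h : x ~r y) (hy : ∀ z, y ~r z → y ≤ z) : lexMinRotation x = y := by
  have hmem : y ∈ List.insertionSort (· ≤ ·) (rotations x) :=
    (List.perm_insertionSort _ _).mem_iff.2 ((mem_rotations_iff hx).2 h)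
  apply le_antisymm
  · exact (List.pairwise_insertionSort (· ≤ ·) (rotations x)).headD_le hmem x
  · apply hy
    have hhead : lexMinRotation x ∈ List.insertionSort (· ≤ ·) (rotations x) := by
      unfold lexMinRotation
      cases hs : List.insertionSort (· ≤ ·) (rotations x) with
      | nil => simp [hs] at hmem
      | cons a l => simp
    exact h.symm.trans ((mem_rotations_iff hx).1 ((List.perm_insertionSort _ _).mem_iff.1 hhead))

theorem List.nil_le_of_linearOrder {α : Type*} [LinearOrder α] (l : List α) :
    ([] : List α) ≤ l := by
  cases l with
  | nil => exact le_rfl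
  | cons a l => exact le_of_lt (show List.Lex (· < ·) [] (a :: l) from .nil)

theorem List.cons_le_cons_iff_of_linearOrder {α : Type*} [LinearOrder α] {a b : α}
    {l m : List α} : a :: l ≤ b :: m ↔ a < b ∨ a = b ∧ l ≤ m := by
  have hlt : a :: l < b :: m ↔ a < b ∨ a = b ∧ l < m := List.cons_lex_cons_iff
  rw [le_iff_lt_or_eq, hlt, le_iff_lt_or_eq, List.cons.injEq]
  tauto

theorem eq_zero_or_eq_one_of_fin_two (c : Fin 2) : c = 0 ∨ c = 1 := by
  omega

theorem List.IsRotated.exists_append {α : Type*} {x y : List α} (h : x ~r y) :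
    ∃ u v, x = u ++ v ∧ y = v ++ u := by
  obtain ⟨n, hn, rfl⟩ := List.isRotated_iff_mod.1 h
  exact ⟨x.take n, x.drop n, (List.take_append_drop n x).symm,
    List.rotate_eq_drop_append_take hn⟩

@[simp] theorem theta_nil : theta [] = [] := rfl

@[simp] theorem theta_zero_cons (w : List (Fin 2)) : theta (0 :: w) = 0 :: 0 :: 1 :: theta w := rfl

@[simp] theorem theta_one_cons (w : List (Fin 2)) : theta (1 :: w) = 0 :: 1 :: theta w := rfl

@[simp] theorem theta_append (u v : List (Fin 2)) : theta (u ++ v) = theta u ++ theta v := by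
  simp [theta]

theorem theta_isRotated {x y : List (Fin 2)} (h : x ~r y) : theta x ~r theta y := by
  obtain ⟨u, v, rfl, rfl⟩ := h.exists_append
  simpa using List.isRotated_append

theorem theta_mono {x y : List (Fin 2)} (h : x ≤ y) : theta x ≤ theta y := by
  induction x generalizing y with
  | nil => exact List.nil_le_of_linearOrder _
  | cons c x ih =>
    rcases y with _ | ⟨d, y⟩
    · cases le_antisymm h (List.nil_le_of_linearOrder _)
    · rw [List.cons_le_cons_iff_of_linearOrder] at h
      rcases eq_zero_or_eq_one_of_fin_two c with rfl | rfl <;>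
        rcases eq_zero_or_eq_one_of_fin_two d with rfl | rfl <;>
        simp_all [List.cons_le_cons_iff_of_linearOrder]

/-- A cut of `theta w` either lies between two images of letters, or what follows it starts with
`01` or `1`, the former only if `w` contains the letter `0`. -/
theorem theta_eq_append {w u v : List (Fin 2)} (h : theta w = u ++ v) :
    (∃ p q, w = p ++ q ∧ u = theta p ∧ v = theta q) ∨
      (∃ v', v = 1 :: v') ∨ (0 ∈ w ∧ ∃ v', v = 0 :: 1 :: v') := by
  induction w generalizing u with
  | nil =>
    obtain ⟨rfl, rfl⟩ := List.append_eq_nil_iff.1 h.symm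
    exact Or.inl ⟨[], [], rfl, rfl, rfl⟩
  | cons c w ih =>
    have step (u' : List (Fin 2)) (hu : u = theta [c] ++ u') (h' : theta w = u' ++ v) :
        (∃ p q, c :: w = p ++ q ∧ u = theta p ∧ v = theta q) ∨
          (∃ v', v = 1 :: v') ∨ (0 ∈ c :: w ∧ ∃ v', v = 0 :: 1 :: v') := by
      rcases ih h' with ⟨p, q, rfl, rfl, rfl⟩ | h₁ | ⟨h₀, h₁⟩
      · exact Or.inl ⟨c :: p, q, rfl, by rw [hu, ← theta_append]; rfl, rfl⟩
      · exact Or.inr (Or.inl h₁)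
      · exact Or.inr (Or.inr ⟨List.mem_cons_of_mem _ h₀, h₁⟩)
    rcases u with _ | ⟨x, u⟩
    · exact Or.inl ⟨[], c :: w, rfl, rfl, h.symm⟩
    rcases eq_zero_or_eq_one_of_fin_two c with rfl | rfl
    · simp only [theta_zero_cons, List.cons_append, List.cons.injEq] at h
      obtain ⟨rfl, h⟩ := h
      rcases u with _ | ⟨y, _ | ⟨z, u⟩⟩
      · exact Or.inr (Or.inr ⟨List.mem_cons_self, _, h.symm⟩)
      · simp only [List.cons_append, List.nil_append, List.cons.injEq] at h
        exact Or.inr (Or.inl ⟨_, h.2.symm⟩)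
      · simp only [List.cons_append, List.cons.injEq] at h
        obtain ⟨rfl, rfl, h⟩ := h
        exact step u rfl h
    · simp only [theta_one_cons, List.cons_append, List.cons.injEq] at h
      obtain ⟨rfl, h⟩ := h
      rcases u with _ | ⟨y, u⟩
      · exact Or.inr (Or.inl ⟨_, h.symm⟩)
      · simp only [List.cons_append, List.cons.injEq] at h
        obtain ⟨rfl, h⟩ := h
        exact step u rfl h

/-- `theta` preserves words that are least among their rotations. -/
theorem theta_le_of_isRotated {w : List (Fin 2)} (hw : ∀ z, w ~r z → w ≤ z) :
    ∀ z, theta w ~r z → theta w ≤ z := by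
  intro z hz
  obtain ⟨u, v, h, rfl⟩ := hz.exists_append
  rcases theta_eq_append h with ⟨p, q, rfl, rfl, rfl⟩ | ⟨v', rfl⟩ | ⟨h₀, v', rfl⟩
  · rw [← theta_append q p]
    exact theta_mono (hw _ List.isRotated_append)
  · rcases w with _ | ⟨c, w⟩
    · exact List.nil_le_of_linearOrder _
    · rcases eq_zero_or_eq_one_of_fin_two c with rfl | rfl <;>
        simp [List.cons_le_cons_iff_of_linearOrder]
  · obtain ⟨p, q, hpq⟩ := List.append_of_mem h₀
    have hle : w ≤ 0 :: q ++ p := hw _ (hpq ▸ List.isRotated_append)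
    rcases w with _ | ⟨c, w⟩
    · exact List.nil_le_of_linearOrder _
    · rcases eq_zero_or_eq_one_of_fin_two c with rfl | rfl
      · simp [List.cons_le_cons_iff_of_linearOrder]
      · simp [List.cons_le_cons_iff_of_linearOrder] at hle

/-- The square of the Fibonacci morphism: `a ↦ aba`, `b ↦ ab`. -/
def fibMorphismSq (w : List (Fin 2)) : List (Fin 2) :=
  (w.map (fun c => if c = 0 then [0, 1, 0] else [0, 1])).flatten

theorem fibMorphismSq_append (u v : List (Fin 2)) :
    fibMorphismSq (u ++ v) = fibMorphismSq u ++ fibMorphismSq v := by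
  simp [fibMorphismSq]

theorem fibWord_add_two (n : ℕ) : fibWord (n + 2) = fibMorphismSq (fibWord n) := by
  induction n using Nat.twoStepInduction with
  | zero => rfl
  | one => rfl
  | more n ih₀ ih₁ =>
    calc fibWord (n + 2 + 2) = fibWord (n + 1 + 2) ++ fibWord (n + 2) := rfl
      _ = fibMorphismSq (fibWord (n + 1) ++ fibWord n) := by
        rw [ih₀, ih₁, fibMorphismSq_append]

theorem fibMorphismSq_append_eq (w : List (Fin 2)) :
    fibMorphismSq w ++ [0, 1] = [0, 1] ++ theta w := by
  induction w with
  | nil => rfl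
  | cons c w ih =>
    rw [← List.singleton_append, fibMorphismSq_append, List.append_assoc, ih]
    fin_cases c <;> rfl

theorem fibMorphismSq_isRotated_theta (w : List (Fin 2)) : fibMorphismSq w ~r theta w := by
  obtain rfl | ⟨x, hx⟩ : w = [] ∨ ∃ x, fibMorphismSq w = [0, 1] ++ x := by
    rcases w with _ | ⟨c, w⟩
    · exact Or.inl rfl
    · fin_cases c
      · exact Or.inr ⟨0 :: fibMorphismSq w, rfl⟩
      · exact Or.inr ⟨fibMorphismSq w, rfl⟩
  · exact List.IsRotated.refl _
  · have h := fibMorphismSq_append_eq w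
    rw [hx, List.append_assoc, List.append_cancel_left_eq] at h
    rw [hx, ← h]
    exact List.isRotated_append

theorem fibWord_isRotated_theta_iterate (k : ℕ) : fibWord (2 * k) ~r theta^[k] [1] := by
  induction k with
  | zero => exact List.IsRotated.refl _
  | succ k ih =>
    rw [Nat.mul_succ, fibWord_add_two, Function.iterate_succ_apply']
    exact (fibMorphismSq_isRotated_theta _).trans (theta_isRotated ih)

theorem theta_iterate_le_of_isRotated (k : ℕ) :
    ∀ z, theta^[k] [1] ~r z → theta^[k] [1] ≤ z := by
  induction k with
  | zero =>
    intro z hz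
    rw [Function.iterate_zero_apply, List.isRotated_singleton_iff'.1 hz]
  | succ k ih =>
    rw [Function.iterate_succ_apply']
    exact theta_le_of_isRotated ih

theorem fibWord_ne_nil (n : ℕ) : fibWord n ≠ [] := by
  induction n using Nat.twoStepInduction with
  | zero => simp [fibWord, fibWordG]
  | one => simp [fibWord, fibWordG]
  | more n _ ih => exact List.append_ne_nil_of_left_ne_nil ih _

/-- for every `k ≥ 0`, `F*_{2k} = θ^k(b)`. -/
theorem stmt6 (k : ℕ) : lexMinRotation (fibWord (2 * k)) = theta^[k] [1] := by
  exact lexMinRotation_eq_of_isRotated (fibWord_ne_nil _) (fibWord_isRotated_theta_iterate k)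
    (theta_iterate_le_of_isRotated k)
end
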